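/- arXiv:1912.11265 — 2 statements merged into one kernel-verified Lean document; each statement's English description precedes it below -/
import Mathlib

section
/- Let n ≥ 1. There exists a unique matrix Q, with rows indexed by B, columns indexed by S_n, and entries in ℤ[x_1, …, x_n], such that P·Q = Δ^{n!}·Id (the identity matrix with index set S_n, scaled by Δ^{n!}) and Q·P = Δ^{n!}·Id (the identity matrix with index set B, scaled by Δ^{n!}). -/
/-!
Work in ℤ[x_1, …, x_n].  `Vdm` is the Vandermonde product ∏_{i<j} (x_i − x_j),
`TupleB` is the set of exponent tuples `a` with `0 ≤ a_i ≤ i − 1`, `xB a` is the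
monomial `x^a`, and `matP` is the n! × n! matrix with rows indexed by permutations σ,
columns indexed by `TupleB`, and entries `σ(x^a)`.
-/

open MvPolynomial

/-- The index set `B`: tuples `(a_1, …, a_n)` with `0 ≤ a_i ≤ i - 1` (in 1-indexed
notation), i.e. `a i ≤ i` in 0-indexed notation.  It has cardinality `n!`. -/
abbrev TupleB (n : ℕ) : Type := ∀ i : Fin n, Fin (i.1 + 1)

/-- The monomial `x_a = x_1^{a_1} ⋯ x_n^{a_n}` for `a ∈ B`. -/
noncomputable def xB {n : ℕ} (a : TupleB n) : MvPolynomial (Fin n) ℤ :=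
  ∏ i : Fin n, (X i : MvPolynomial (Fin n) ℤ) ^ (a i : ℕ)

/-- `Δ = ∏_{1 ≤ i < j ≤ n} (x_i − x_j)`. -/
noncomputable def Vdm (n : ℕ) : MvPolynomial (Fin n) ℤ :=
  ∏ p ∈ Finset.univ.filter (fun p : Fin n × Fin n => p.1 < p.2), (X p.1 - X p.2)

/-- The matrix `P` with `P_{σ, a} = σ(x_a)`, the permutation σ acting by permuting
the variables. -/
noncomputable def matP (n : ℕ) :
    Matrix (Equiv.Perm (Fin n)) (TupleB n) (MvPolynomial (Fin n) ℤ) :=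
  fun σ a => rename σ (xB a)

/-- In a commutative domain, a one-sided inverse up to a nonzero scalar, between square matrices
indexed by types of equal cardinality, is a two-sided one. -/
theorem Matrix.mul_eq_smul_one_symm {R m k : Type*} [CommRing R] [IsDomain R]
    [Fintype m] [DecidableEq m] [Fintype k] [DecidableEq k] (e : m ≃ k)
    {A : Matrix m k R} {B : Matrix k m R} {c : R} (hc : c ≠ 0)
    (h : A * B = c • (1 : Matrix m m R)) : B * A = c • (1 : Matrix k k R) := by
  set A' : Matrix k k R := A.submatrix e.symm id with hA'
  set B' : Matrix k k R := B.submatrix id e.symm with hB'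
  have hAB : A' * B' = c • (1 : Matrix k k R) := by
    rw [hA', hB', ← Matrix.submatrix_mul A B e.symm id e.symm Function.bijective_id, h]
    simp [Matrix.submatrix_smul]
  have hBA : B' * A' = B * A := by
    rw [hA', hB', Matrix.submatrix_mul_equiv B A id e.symm id, Matrix.submatrix_id_id]
  have hdet : A'.det ≠ 0 := by
    intro h0
    have := congrArg Matrix.det hAB
    rw [Matrix.det_mul, h0, zero_mul, Matrix.det_smul, Matrix.det_one, mul_one] at this
    exact pow_ne_zero _ hc this.symm
  rw [← hBA]
  apply smul_right_injective _ hdet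
  calc A'.det • (B' * A') = A'.adjugate * A' * (B' * A') := by
        rw [Matrix.adjugate_mul, Matrix.smul_mul, Matrix.one_mul]
    _ = A'.adjugate * (A' * B') * A' := by simp only [Matrix.mul_assoc]
    _ = A'.det • c • (1 : Matrix k k R) := by
        rw [hAB, Matrix.mul_smul, Matrix.mul_one, Matrix.smul_mul, Matrix.adjugate_mul, smul_comm]

theorem card_tupleB (n : ℕ) : Fintype.card (TupleB n) = n.factorial := by
  rw [Fintype.card_pi]
  simp only [Fintype.card_fin]
  rw [Fin.prod_univ_eq_prod_range (fun i => i + 1) n, Finset.prod_range_add_one_eq_factorial]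

theorem Vdm_ne_zero (n : ℕ) : Vdm n ≠ 0 := by
  refine Finset.prod_ne_zero_iff.mpr fun p hp => sub_ne_zero.mpr fun h => ?_
  exact (Finset.mem_filter.mp hp).2.ne (X_injective h)

/-- The Vandermonde product of a permutation of the variables divides `Δ`. -/
theorem prod_X_perm_sub_dvd_Vdm {n : ℕ} (τ : Equiv.Perm (Fin n)) :
    (∏ i : Fin n, ∏ j ∈ Finset.Iio i, (X (τ i) - X (τ j) : MvPolynomial (Fin n) ℤ)) ∣ Vdm n := by
  have hdet (v : Fin n → MvPolynomial (Fin n) ℤ) :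
      ∏ i : Fin n, ∏ j ∈ Finset.Iio i, (v i - v j) = (Matrix.vandermonde v).det := by
    rw [Matrix.det_vandermonde]
    exact Finset.prod_comm' (by simp)
  have hperm : (Matrix.vandermonde fun i => (X (τ i) : MvPolynomial (Fin n) ℤ)).det =
      ((Equiv.Perm.sign τ : ℤ) : MvPolynomial (Fin n) ℤ) * (Matrix.vandermonde X).det :=
    Matrix.det_permute τ (Matrix.vandermonde (X : Fin n → MvPolynomial (Fin n) ℤ))
  have hVdm : Vdm n = ∏ i : Fin n, ∏ j ∈ Finset.Ioi i, (X i - X j) := by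
    rw [Vdm, Finset.prod_filter, Fintype.prod_prod_type]
    refine Finset.prod_congr rfl fun i _ => ?_
    rw [← Finset.prod_filter]
    exact Finset.prod_congr (by ext; simp) fun _ _ => rfl
  rw [hdet fun i => X (τ i), hperm]
  have hsign : IsUnit (((Equiv.Perm.sign τ : ℤ) : MvPolynomial (Fin n) ℤ)) :=
    (Equiv.Perm.sign τ).isUnit.map (Int.castRingHom (MvPolynomial (Fin n) ℤ))
  rw [hsign.mul_left_dvd, Matrix.det_vandermonde, hVdm]
  refine Finset.prod_dvd_prod_of_dvd _ _ fun i _ => Finset.prod_dvd_prod_of_dvd _ _ fun j _ => ?_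
  rw [← neg_sub, neg_dvd]

/-- A permutation of `Fin n` with `i ≤ σ i` for all `i` is the identity. -/
theorem Equiv.Perm.eq_one_of_forall_le {n : ℕ} (σ : Equiv.Perm (Fin n)) (h : ∀ i, i ≤ σ i) :
    σ = 1 := by
  have hsum : ∑ i : Fin n, (i : ℕ) = ∑ i : Fin n, (σ i : ℕ) := (Equiv.sum_comp σ fun i : Fin n => (i : ℕ)).symm
  have := (Finset.sum_eq_sum_iff_of_le fun i _ => Fin.le_def.mp (h i)).mp hsum
  ext i
  exact (this i (Finset.mem_univ i)).symm

/-- The polynomial `∏_{j < i} (T - x_{τ j})` in `T`. -/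
noncomputable def rootPoly {n : ℕ} (τ : Equiv.Perm (Fin n)) (i : Fin n) :
    Polynomial (MvPolynomial (Fin n) ℤ) :=
  ∏ j ∈ Finset.Iio i, (Polynomial.X - Polynomial.C (X (τ j)))

/-- The coefficient of `x_a` in the double Schubert polynomial `∏_{j < i} (x_i - x_{τ j})`, where
the `x_{τ j}` are treated as scalars. -/
noncomputable def schubertCoeff {n : ℕ} (a : TupleB n) (τ : Equiv.Perm (Fin n)) :
    MvPolynomial (Fin n) ℤ :=
  ∏ i : Fin n, (rootPoly τ i).coeff (a i)

theorem sum_matP_mul_schubertCoeff {n : ℕ} (σ τ : Equiv.Perm (Fin n)) :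
    ∑ a, matP n σ a * schubertCoeff a τ =
      ∏ i : Fin n, ∏ j ∈ Finset.Iio i, (X (σ i) - X (τ j)) := by
  have heval (i : Fin n) : ∏ j ∈ Finset.Iio i, (X (σ i) - X (τ j) : MvPolynomial (Fin n) ℤ) =
      ∑ k : Fin (i.1 + 1), X (σ i) ^ (k : ℕ) * (rootPoly τ i).coeff k := by
    have hdeg : (rootPoly τ i).natDegree < i.1 + 1 := by
      rw [rootPoly, Polynomial.natDegree_finsetProd_X_sub_C_eq_card, Fin.card_Iio]
      exact Nat.lt_succ_self _
    have heval_prod : (rootPoly τ i).eval (X (σ i)) = ∏ j ∈ Finset.Iio i, (X (σ i) - X (τ j)) := by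
      simp [rootPoly, Polynomial.eval_prod]
    rw [← heval_prod, Polynomial.eval_eq_sum_range' hdeg,
      ← Fin.sum_univ_eq_sum_range (fun k => (rootPoly τ i).coeff k * X (σ i) ^ k)]
    exact Finset.sum_congr rfl fun _ _ => mul_comm _ _
  simp only [heval]
  rw [Finset.prod_univ_sum, Fintype.piFinset_univ]
  refine Finset.sum_congr rfl fun a _ => ?_
  rw [Finset.prod_mul_distrib, schubertCoeff, matP, xB, map_prod]
  simp only [map_pow, rename_X]

theorem prod_X_perm_sub_eq_zero {n : ℕ} {σ τ : Equiv.Perm (Fin n)} (h : σ ≠ τ) :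
    ∏ i : Fin n, ∏ j ∈ Finset.Iio i, (X (σ i) - X (τ j) : MvPolynomial (Fin n) ℤ) = 0 := by
  obtain ⟨i, hi⟩ : ∃ i, (τ⁻¹ * σ) i < i := by
    by_contra! hle
    exact h (inv_mul_eq_one.mp (Equiv.Perm.eq_one_of_forall_le _ hle)).symm
  refine Finset.prod_eq_zero (Finset.mem_univ i) (Finset.prod_eq_zero (Finset.mem_Iio.mpr hi) ?_)
  simp

/-- there is a unique matrix `Q`, with rows indexed by `B` and columns
indexed by `S_n`, such that `P·Q = Δ^{n!}·Id` and `Q·P = Δ^{n!}·Id`. -/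
theorem exists_unique_adjugate_matQ (n : ℕ) (hn : 1 ≤ n) :
    ∃! Q : Matrix (TupleB n) (Equiv.Perm (Fin n)) (MvPolynomial (Fin n) ℤ),
      matP n * Q = Vdm n ^ (Nat.factorial n) •
          (1 : Matrix (Equiv.Perm (Fin n)) (Equiv.Perm (Fin n)) (MvPolynomial (Fin n) ℤ)) ∧
      Q * matP n = Vdm n ^ (Nat.factorial n) •
          (1 : Matrix (TupleB n) (TupleB n) (MvPolynomial (Fin n) ℤ)) := by
  have hc : Vdm n ^ n.factorial ≠ 0 := pow_ne_zero _ (Vdm_ne_zero n)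
  choose u hu using fun τ : Equiv.Perm (Fin n) =>
    (prod_X_perm_sub_dvd_Vdm τ).trans (dvd_pow_self (Vdm n) n.factorial_ne_zero)
  let Q : Matrix (TupleB n) (Equiv.Perm (Fin n)) (MvPolynomial (Fin n) ℤ) :=
    Matrix.of fun a τ => schubertCoeff a τ * u τ
  have hPQ : matP n * Q = Vdm n ^ n.factorial • (1 : Matrix _ _ (MvPolynomial (Fin n) ℤ)) := by
    ext1 σ τ
    simp only [Matrix.mul_apply, Q, Matrix.of_apply, ← mul_assoc]
    rw [← Finset.sum_mul, sum_matP_mul_schubertCoeff, Matrix.smul_apply]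
    rcases eq_or_ne σ τ with rfl | h
    · rw [Matrix.one_apply_eq, smul_eq_mul, mul_one, hu σ]
    · rw [Matrix.one_apply_ne h, smul_zero, prod_X_perm_sub_eq_zero h, zero_mul]
  have e : Equiv.Perm (Fin n) ≃ TupleB n := Fintype.equivOfCardEq <| by
    rw [card_tupleB, Fintype.card_perm, Fintype.card_fin]
  have hQP := Matrix.mul_eq_smul_one_symm e hc hPQ
  refine ⟨Q, ⟨hPQ, hQP⟩, fun Q' ⟨hPQ', _⟩ => smul_right_injective _ hc ?_⟩
  calc Vdm n ^ n.factorial • Q' = Q * matP n * Q' := by rw [hQP, Matrix.smul_mul, Matrix.one_mul]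
    _ = Q * (matP n * Q) := by rw [Matrix.mul_assoc, hPQ', hPQ]
    _ = Vdm n ^ n.factorial • Q := by rw [hPQ, Matrix.mul_smul, Matrix.mul_one]
end

section
/- Let E be a field, n ≥ 1, and let H ⊆ GL_n(E) be a subgroup acting on M_n(E) by conjugation. Then the following conditions are equivalent: (A) for every simple E[H]-submodule V of M_n(E), there exist h ∈ H whose characteristic polynomial has n distinct roots in E and a root α of it such that tr(e_{h,α}·v) ≠ 0 for some v ∈ V; (B) for every nonzero E[H]-submodule V of M_n(E), there exists h ∈ H whose characteristic polynomial has n distinct roots in E such that V is not contained in the image of the map M_n(E) → M_n(E), X ↦ hXh⁻¹ − X. -/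
/-!
STATEMENT 11 (equivalence of conditions (2) and (3) of Lemma 2.16 of the paper).
For a subgroup `H ⊆ GL_n(E)` acting on `M_n(E)` by conjugation, condition (A) on
simple submodules is equivalent to condition (B) on all nonzero submodules.
-/

open Polynomial

variable {E : Type*} [Field E] {n : ℕ}

/-- `g` has characteristic polynomial with the `n` distinct roots `αs 0, …, αs (n-1)`
in `E` (in particular `g` is regular semisimple). -/
def HasDistinctEigenvalues (g : Matrix (Fin n) (Fin n) E) (αs : Fin n → E) : Prop :=
  Function.Injective αs ∧ g.charpoly = ∏ i : Fin n, (X - C (αs i))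

/-- The `g`-equivariant projection `e_{g,αs i}` onto the `αs i`-eigenspace of `g`:
`e_{g,α} = ∏_{β ≠ α} (α − β)⁻¹ (g − β·1)`, written as a polynomial evaluated at `g`. -/
noncomputable def eigenProjection (g : Matrix (Fin n) (Fin n) E) (αs : Fin n → E)
    (i : Fin n) : Matrix (Fin n) (Fin n) E :=
  Polynomial.aeval g (∏ j ∈ Finset.univ.erase i, (C (αs i - αs j)⁻¹ * (X - C (αs j))))

/-- An `E`-subspace `V ⊆ M_n(E)` is stable under the conjugation (adjoint) action of
the subgroup `H ⊆ GL_n(E)`, i.e. it is an `E[H]`-submodule of `M_n(E)`. -/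
def ConjStable (H : Subgroup (GL (Fin n) E))
    (V : Submodule E (Matrix (Fin n) (Fin n) E)) : Prop :=
  ∀ h ∈ H, ∀ v ∈ V, (h : Matrix (Fin n) (Fin n) E) * v *
    ((h⁻¹ : GL (Fin n) E) : Matrix (Fin n) (Fin n) E) ∈ V

/-- `V` is a simple `E[H]`-submodule of `M_n(E)` for the conjugation action of `H`. -/
def IsSimpleConjSubmodule (H : Subgroup (GL (Fin n) E))
    (V : Submodule E (Matrix (Fin n) (Fin n) E)) : Prop :=
  ConjStable H V ∧ V ≠ ⊥ ∧
    ∀ W : Submodule E (Matrix (Fin n) (Fin n) E),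
      ConjStable H W → W ≤ V → W = ⊥ ∨ W = V

/-- The `E`-linear map `M_n(E) → M_n(E)`, `X ↦ hXh⁻¹ − X`, i.e. `Ad(h) − 1`. -/
noncomputable def adSubOne (h : GL (Fin n) E) :
    Matrix (Fin n) (Fin n) E →ₗ[E] Matrix (Fin n) (Fin n) E :=
  (LinearMap.mulRight E ((h⁻¹ : GL (Fin n) E) : Matrix (Fin n) (Fin n) E)).comp
      (LinearMap.mulLeft E ((h : GL (Fin n) E) : Matrix (Fin n) (Fin n) E)) -
    LinearMap.id

open Matrix in
/-- A matrix with `n` distinct eigenvalues is diagonalizable. -/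
theorem HasDistinctEigenvalues.exists_mul_diagonal {g : Matrix (Fin n) (Fin n) E} {αs : Fin n → E}
    (hg : HasDistinctEigenvalues g αs) :
    ∃ P : GL (Fin n) E, g * (P : Matrix (Fin n) (Fin n) E) = P * Matrix.diagonal αs := by
  have hex (i : Fin n) : ∃ w : Fin n → E, w ≠ 0 ∧ g *ᵥ w = αs i • w := by
    have hdet : (Matrix.scalar (Fin n) (αs i) - g).det = 0 := by
      rw [← Matrix.eval_charpoly, hg.2, Polynomial.eval_prod]
      exact Finset.prod_eq_zero (Finset.mem_univ i) (by simp)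
    obtain ⟨w, hw, h⟩ := Matrix.exists_mulVec_eq_zero_iff.mpr hdet
    refine ⟨w, hw, ?_⟩
    rw [Matrix.sub_mulVec, sub_eq_zero] at h
    rw [← h]
    ext j
    simp [Matrix.mulVec_diagonal]
  choose w hw0 hw using hex
  have hli : LinearIndependent E w :=
    Module.End.eigenvectors_linearIndependent' (Matrix.toLin' g) αs hg.1 w fun i =>
      ⟨Module.End.mem_eigenspace_iff.mpr (by simpa using hw i), hw0 i⟩
  have hunit : IsUnit (Matrix.of w)ᵀ :=
    (Matrix.linearIndependent_cols_iff_isUnit (A := (Matrix.of w)ᵀ)).mp hli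
  refine ⟨hunit.unit, ?_⟩
  ext i j
  rw [Matrix.mul_diagonal]
  simpa [Matrix.mul_apply, Matrix.mulVec, dotProduct, mul_comm] using congrFun (hw j) i

theorem aeval_mul_eq_mul_aeval {R A : Type*} [CommSemiring R] [Semiring A] [Algebra R A]
    {a b x : A} (h : a * x = x * b) (p : R[X]) :
    aeval a p * x = x * aeval b p := by
  induction p using Polynomial.induction_on' with
  | add p q hp hq => simp [add_mul, mul_add, hp, hq]
  | monomial k r =>
    have hk : a ^ k * x = x * b ^ k :=
      (SemiconjBy.pow_right (show SemiconjBy x b a from h.symm) k).symm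
    rw [aeval_monomial, aeval_monomial, mul_assoc, hk, ← mul_assoc, ← mul_assoc,
      Algebra.commutes]

theorem aeval_diagonal (d : Fin n → E) (p : E[X]) :
    aeval (Matrix.diagonal d) p = Matrix.diagonal fun i => p.eval (d i) := by
  have := aeval_algHom_apply (Matrix.diagonalAlgHom (n := Fin n) (α := E) E) d p
  simp only [Matrix.diagonalAlgHom_apply] at this
  rw [this]
  congr 1
  ext i
  rw [← Pi.evalAlgHom_apply (R := E) (A := fun _ => E) i (aeval d p), ← aeval_algHom_apply]
  simp [coe_aeval_eq_eval]

/-- In an eigenbasis, the projection onto an eigenline is a diagonal matrix unit. -/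
theorem eigenProjection_mul {g P : Matrix (Fin n) (Fin n) E} {αs : Fin n → E}
    (hα : Function.Injective αs) (hP : g * P = P * Matrix.diagonal αs) (i : Fin n) :
    eigenProjection g αs i * P = P * Matrix.single i i 1 := by
  rw [eigenProjection, aeval_mul_eq_mul_aeval hP, aeval_diagonal, ← Matrix.diagonal_single]
  congr 2
  ext k
  rw [eval_prod]
  by_cases hk : k = i
  · subst hk
    rw [Pi.single_eq_same]
    refine Finset.prod_eq_one fun j hj => ?_
    have : αs k - αs j ≠ 0 := sub_ne_zero.mpr fun h => (Finset.mem_erase.mp hj).1 (hα h).symm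
    simp [this]
  · rw [Pi.single_eq_of_ne hk]
    exact Finset.prod_eq_zero (Finset.mem_erase.mpr ⟨hk, Finset.mem_univ k⟩) (by simp)

/-- In an eigenbasis, `tr (e_{g,αs i} * v)` is the `i`-th diagonal entry of `v`. -/
theorem trace_eigenProjection_mul {g : Matrix (Fin n) (Fin n) E} {αs : Fin n → E}
    (hα : Function.Injective αs) {P : GL (Fin n) E}
    (hP : g * (P : Matrix (Fin n) (Fin n) E) = P * Matrix.diagonal αs) (i : Fin n)
    (v : Matrix (Fin n) (Fin n) E) :
    Matrix.trace (eigenProjection g αs i * v) =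
      (((P⁻¹ : GL (Fin n) E) : Matrix (Fin n) (Fin n) E) * v * P) i i := by
  have he : eigenProjection g αs i =
      (P : Matrix (Fin n) (Fin n) E) * Matrix.single i i 1 *
        ((P⁻¹ : GL (Fin n) E) : Matrix (Fin n) (Fin n) E) := by
    rw [← eigenProjection_mul hα hP, Units.mul_inv_cancel_right]
  rw [he, mul_assoc, mul_assoc, Matrix.trace_mul_comm, mul_assoc, Matrix.trace_single_mul, one_smul]

theorem mem_range_adSubOne_iff {h : GL (Fin n) E} {v : Matrix (Fin n) (Fin n) E} :
    v ∈ LinearMap.range (adSubOne h) ↔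
      ∃ x : Matrix (Fin n) (Fin n) E, (h : Matrix (Fin n) (Fin n) E) * x - x * h = v * h := by
  refine exists_congr fun x => ?_
  rw [← Units.mul_left_inj h]
  simp [adSubOne, sub_mul]

/-- For `h` with distinct eigenvalues, `Ad(h) - 1` has image the common kernel of the functionals
`v ↦ tr (e_{h,α} * v)`. -/
theorem HasDistinctEigenvalues.mem_range_adSubOne_iff {h : GL (Fin n) E} {αs : Fin n → E}
    (hh : HasDistinctEigenvalues (h : Matrix (Fin n) (Fin n) E) αs)
    {v : Matrix (Fin n) (Fin n) E} :
    v ∈ LinearMap.range (adSubOne h) ↔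
      ∀ i, Matrix.trace (eigenProjection (h : Matrix (Fin n) (Fin n) E) αs i * v) = 0 := by
  constructor
  · rintro ⟨x, rfl⟩ i
    have hcomm : Commute (eigenProjection (h : Matrix (Fin n) (Fin n) E) αs i) h :=
      aeval_mul_eq_mul_aeval rfl _
    simp only [adSubOne, LinearMap.sub_apply, LinearMap.comp_apply, LinearMap.mulLeft_apply,
      LinearMap.mulRight_apply, LinearMap.id_apply, mul_sub, Matrix.trace_sub]
    rw [← mul_assoc, ← mul_assoc, hcomm.eq, Matrix.trace_mul_comm, mul_assoc,
      Units.inv_mul_cancel_left, sub_self]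
  · intro hv
    obtain ⟨P, hP⟩ := hh.exists_mul_diagonal
    simp_rw [trace_eigenProjection_mul hh.1 hP] at hv
    set Q : Matrix (Fin n) (Fin n) E := ((P⁻¹ : GL (Fin n) E) : Matrix (Fin n) (Fin n) E)
    set y := Q * v * P with hy
    let z : Matrix (Fin n) (Fin n) E := Matrix.of fun i j => y i j * αs j / (αs i - αs j)
    have hz : Matrix.diagonal αs * z - z * Matrix.diagonal αs = y * Matrix.diagonal αs := by
      ext i j
      simp only [Matrix.sub_apply, Matrix.diagonal_mul, Matrix.mul_diagonal, z, Matrix.of_apply]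
      by_cases hij : i = j
      · subst hij
        simp [hv]
      · have : αs i - αs j ≠ 0 := sub_ne_zero.mpr fun h => hij (hh.1 h)
        field_simp
    rw [_root_.mem_range_adSubOne_iff]
    refine ⟨P * z * Q, ?_⟩
    have hPQ : (P : Matrix (Fin n) (Fin n) E) * Q = 1 := P.mul_inv
    have hQP : Q * (P : Matrix (Fin n) (Fin n) E) = 1 := P.inv_mul
    have hQh : Q * (h : Matrix (Fin n) (Fin n) E) = Matrix.diagonal αs * Q := by
      calc Q * (h : Matrix (Fin n) (Fin n) E) = Q * (h * P) * Q := by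
            rw [mul_assoc, mul_assoc, hPQ, mul_one]
        _ = Matrix.diagonal αs * Q := by rw [hP, ← mul_assoc, hQP, one_mul]
    calc (h : Matrix (Fin n) (Fin n) E) * (P * z * Q) - P * z * Q * h
        = P * (Matrix.diagonal αs * z - z * Matrix.diagonal αs) * Q := by
          rw [mul_assoc _ Q, hQh, ← mul_assoc, ← mul_assoc, hP]
          noncomm_ring
      _ = (P * Q) * v * (P * (Matrix.diagonal αs * Q)) := by
          rw [hz, hy]
          simp only [mul_assoc]
      _ = v * h := by rw [← hQh, ← mul_assoc _ Q, hPQ, one_mul, one_mul]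

theorem ConjStable.exists_isSimpleConjSubmodule_le {H : Subgroup (GL (Fin n) E)}
    {V : Submodule E (Matrix (Fin n) (Fin n) E)} (hV : ConjStable H V) (hV0 : V ≠ ⊥) :
    ∃ W ≤ V, IsSimpleConjSubmodule H W := by
  obtain ⟨W, ⟨hWV, hW, hW0⟩, hmin⟩ := wellFounded_lt.has_min
    {W : Submodule E (Matrix (Fin n) (Fin n) E) | W ≤ V ∧ ConjStable H W ∧ W ≠ ⊥}
    ⟨V, le_rfl, hV, hV0⟩
  refine ⟨W, hWV, hW, hW0, fun U hU hUW => ?_⟩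
  by_contra! hne
  exact hmin U ⟨hUW.trans hWV, hU, hne.1⟩ (lt_of_le_of_ne hUW hne.2)

theorem enormous_iff_not_le_range_adSubOne (hn : 1 ≤ n) (H : Subgroup (GL (Fin n) E)) :
    (∀ V : Submodule E (Matrix (Fin n) (Fin n) E), IsSimpleConjSubmodule H V →
      ∃ h ∈ H, ∃ αs : Fin n → E,
        HasDistinctEigenvalues (h : Matrix (Fin n) (Fin n) E) αs ∧
        ∃ i : Fin n, ∃ v ∈ V,
          Matrix.trace (eigenProjection (h : Matrix (Fin n) (Fin n) E) αs i * v) ≠ 0) ↔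
    (∀ V : Submodule E (Matrix (Fin n) (Fin n) E), ConjStable H V → V ≠ ⊥ →
      ∃ h ∈ H, ∃ αs : Fin n → E,
        HasDistinctEigenvalues (h : Matrix (Fin n) (Fin n) E) αs ∧
        ¬ (V ≤ LinearMap.range (adSubOne h))) := by
  constructor
  · intro hA V hV hV0
    obtain ⟨W, hWV, hW⟩ := hV.exists_isSimpleConjSubmodule_le hV0
    obtain ⟨h, hH, αs, hα, i, v, hv, htr⟩ := hA W hW
    exact ⟨h, hH, αs, hα, fun hle => htr (hα.mem_range_adSubOne_iff.mp (hle (hWV hv)) i)⟩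
  · intro hB V hV
    obtain ⟨h, hH, αs, hα, hle⟩ := hB V hV.1 hV.2.1
    obtain ⟨v, hv, hvr⟩ := SetLike.not_le_iff_exists.mp hle
    rw [hα.mem_range_adSubOne_iff, not_forall] at hvr
    obtain ⟨i, hi⟩ := hvr
    exact ⟨h, hH, αs, hα, i, v, hv, hi⟩
end
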